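/- arXiv:1503.02346 — 4 statements merged into one kernel-verified Lean document; each statement's English description precedes it below -/
import Mathlib

section
/- For every real b > 0 and every real t ≥ 0, the function u ↦ (1+u^b)^t is integrable on (0,1) and ∫_0^1 (1+u^b)^t du = ∑_{n=0}^∞ C(t,n)/(nb+1), where the series on the right converges; here C(t,n) = (∏_{l=0}^{n−1}(t−l))/n! is the generalized binomial coefficient. -/
open MeasureTheory

/-- The generalized binomial coefficient `C(t,n) = (∏_{l=0}^{n−1}(t−l))/n!`. -/
noncomputable def genC (t : ℝ) (n : ℕ) : ℝ :=
  (∏ l ∈ Finset.range n, (t - l)) / (n.factorial : ℝ)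

theorem genC_succ (t : ℝ) (n : ℕ) : genC t (n + 1) = genC t n * (t - n) / (n + 1) := by
  have h : (n.factorial : ℝ) ≠ 0 := by positivity
  have h' : (n : ℝ) + 1 ≠ 0 := by positivity
  simp only [genC, Finset.prod_range_succ, Nat.factorial_succ]
  push_cast
  field_simp

theorem genC_eq_choose (t : ℝ) (n : ℕ) : genC t n = Ring.choose t n := by
  have h : (descPochhammer ℤ n).smeval t = ∏ l ∈ Finset.range n, (t - l) := by
    induction n with
    | zero => simp
    | succ n ih =>
      simp [descPochhammer_succ_right, Polynomial.smeval_mul, Polynomial.smeval_natCast,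
        Finset.prod_range_succ, ih]
  rw [Ring.choose_eq_smul, h, genC, smul_eq_mul, div_eq_inv_mul]

/-- The binomial series converges on the open unit interval. -/
theorem hasSum_genC_mul_pow (t : ℝ) {x : ℝ} (hx : |x| < 1) :
    HasSum (fun n : ℕ => genC t n * x ^ n) ((1 + x) ^ t) := by
  have h := (Real.one_add_rpow_hasFPowerSeriesOnBall_zero (a := t)).hasSum
    (y := x) (by simpa [← ofReal_norm, ENNReal.ofReal_lt_one] using hx)
  simpa [binomialSeries, genC_eq_choose, mul_comm] using h

/-- For `n ≥ t`, the sum of `t * |C(t,n)|` telescopes. -/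
theorem mul_abs_genC {t : ℝ} {n : ℕ} (hn : t ≤ n) :
    t * |genC t n| = n * |genC t n| - (n + 1 : ℕ) * |genC t (n + 1)| := by
  have h' : (0 : ℝ) < n + 1 := by positivity
  rw [genC_succ, abs_div, abs_mul, abs_of_nonpos (sub_nonpos.2 hn), abs_of_pos h']
  push_cast
  field_simp
  ring

theorem summable_abs_genC {t : ℝ} (ht : 0 ≤ t) : Summable (fun n : ℕ => |genC t n|) := by
  rcases ht.eq_or_lt with rfl | ht
  · refine summable_of_ne_finset_zero (s := {0}) fun n hn => ?_
    have : ∏ l ∈ Finset.range n, ((0 : ℝ) - l) = 0 :=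
      Finset.prod_eq_zero (i := 0) (by simpa [Nat.pos_iff_ne_zero] using hn) (by simp)
    rw [genC, this, zero_div, abs_zero]
  · obtain ⟨N, hN⟩ := exists_nat_ge t
    rw [← summable_nat_add_iff N]
    refine summable_of_sum_range_le (c := N * |genC t N| / t) (fun n => abs_nonneg _) fun n => ?_
    have h : t * ∑ i ∈ Finset.range n, |genC t (i + N)| =
        N * |genC t N| - (n + N : ℕ) * |genC t (n + N)| := by
      rw [Finset.mul_sum]
      induction n with
      | zero => simp
      | succ n ih =>
        have hn : t ≤ (n + N : ℕ) := hN.trans (by simp)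
        rw [Finset.sum_range_succ, ih, mul_abs_genC hn, Nat.add_right_comm n 1 N]
        ring
    rw [le_div_iff₀' ht, h]
    exact sub_le_self _ (by positivity)

theorem integrableOn_Ioo_rpow {r : ℝ} (hr : 0 ≤ r) :
    IntegrableOn (fun u : ℝ => u ^ r) (Set.Ioo 0 1) volume :=
  ((Real.continuous_rpow_const hr).integrableOn_Icc (a := 0) (b := 1)).mono_set
    Set.Ioo_subset_Icc_self

theorem integral_Ioo_rpow {r : ℝ} (hr : 0 ≤ r) :
    ∫ u in Set.Ioo (0 : ℝ) 1, u ^ r = 1 / (r + 1) := by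
  rw [← integral_Ioc_eq_integral_Ioo, ← intervalIntegral.integral_of_le zero_le_one,
    integral_rpow (Or.inl (by linarith)), Real.one_rpow, Real.zero_rpow (by positivity), sub_zero]

/-- For `b > 0` and `t ≥ 0`, `u ↦ (1+u^b)^t` is integrable on `(0,1)`,
the series `∑ₙ C(t,n)/(nb+1)` converges, and
`∫_0^1 (1+u^b)^t du = ∑_{n=0}^∞ C(t,n)/(nb+1)`. -/
theorem integral_one_add_rpow_eq_tsum (b t : ℝ) (hb : 0 < b) (ht : 0 ≤ t) :
    IntegrableOn (fun u : ℝ => (1 + u ^ b) ^ t) (Set.Ioo 0 1) volume ∧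
    Summable (fun n : ℕ => genC t n / (n * b + 1)) ∧
    ∫ u in Set.Ioo (0:ℝ) 1, (1 + u ^ b) ^ t = ∑' n : ℕ, genC t n / (n * b + 1) := by
  have hr (n : ℕ) : 0 ≤ n * b := by positivity
  have hint (n : ℕ) : ∫ u in Set.Ioo (0 : ℝ) 1, genC t n * u ^ (n * b) =
      genC t n / (n * b + 1) := by
    rw [integral_const_mul, integral_Ioo_rpow (hr n), mul_one_div]
  have hnorm (n : ℕ) : ∫ u in Set.Ioo (0 : ℝ) 1, ‖genC t n * u ^ (n * b)‖ =
      |genC t n| / (n * b + 1) := by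
    rw [← mul_one_div, ← integral_Ioo_rpow (hr n), ← integral_const_mul]
    refine setIntegral_congr_fun measurableSet_Ioo fun u hu => ?_
    simp [abs_of_nonneg (Real.rpow_nonneg hu.1.le (n * b))]
  have hsum : Summable fun n : ℕ => ∫ u in Set.Ioo (0 : ℝ) 1, ‖genC t n * u ^ (n * b)‖ := by
    simp only [hnorm]
    refine (summable_abs_genC ht).of_nonneg_of_le (fun n => ?_) fun n => ?_
    · have := hr n
      positivity
    · exact div_le_self (abs_nonneg _) (by linarith [hr n])
  have key := hasSum_integral_of_summable_integral_norm
    (fun n : ℕ => (integrableOn_Ioo_rpow (hr n)).const_mul (genC t n)) hsum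
  simp only [hint] at key
  refine ⟨?_, key.summable, ?_⟩
  · have hc : Continuous fun u : ℝ => (1 + u ^ b) ^ t :=
      (continuous_const.add (Real.continuous_rpow_const hb.le)).rpow_const fun _ => Or.inr ht
    exact (hc.integrableOn_Icc (a := 0) (b := 1)).mono_set Set.Ioo_subset_Icc_self
  · rw [key.tsum_eq]
    refine setIntegral_congr_fun measurableSet_Ioo fun u hu => ?_
    have hx : |u ^ b| < 1 := by
      rw [abs_of_nonneg (Real.rpow_nonneg hu.1.le b)]
      exact Real.rpow_lt_one hu.1.le hu.2 hb
    rw [← (hasSum_genC_mul_pow t hx).tsum_eq]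
    refine tsum_congr fun n => ?_
    rw [mul_comm (n : ℝ) b, Real.rpow_mul hu.1.le, Real.rpow_natCast]
end

section
/- For every real b > 0 and every real t with 0 ≤ t < 1, the function u ↦ (1−u^b)^{−t} is integrable on (0,1) and ∫_0^1 (1−u^b)^{−t} du = ∑_{n=0}^∞ D(t,n)/(nb+1), where D(t,n) = (∏_{l=0}^{n−1}(t+l))/n! and the series converges. -/
open MeasureTheory

/-- `D(t,n) = (∏_{l=0}^{n−1}(t+l))/n!`, so that `(−1)^n D(t,n)` is the generalized
binomial coefficient `C(−t,n)`. -/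
noncomputable def genD (t : ℝ) (n : ℕ) : ℝ :=
  (∏ l ∈ Finset.range n, (t + l)) / (n.factorial : ℝ)

theorem genD_eq_multichoose (t : ℝ) (n : ℕ) : genD t n = Ring.multichoose t n := by
  have hprod : (ascPochhammer ℝ n).eval t = ∏ l ∈ Finset.range n, (t + l) := by
    induction n with
    | zero => simp
    | succ k ih =>
      rw [ascPochhammer_succ_eval, Finset.prod_range_succ, ih]
  have h := Ring.factorial_nsmul_multichoose_eq_ascPochhammer t n
  rw [Polynomial.ascPochhammer_smeval_eq_eval, hprod,
    nsmul_eq_mul] at h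
  rw [genD, ← h]
  field_simp

theorem genD_nonneg {t : ℝ} (ht : 0 ≤ t) (n : ℕ) : 0 ≤ genD t n := by
  unfold genD
  positivity

theorem hasSum_genD_mul_pow (t : ℝ) {x : ℝ} (hx : |x| < 1) :
    HasSum (fun n : ℕ => genD t n * x ^ n) ((1 - x) ^ (-t)) := by
  have h := (Real.one_div_one_sub_rpow_hasFPowerSeriesOnBall_zero t).hasSum
    (y := x) (by simpa [enorm_eq_nnnorm] using! hx)
  have hx' : 0 ≤ 1 - x := by linarith [le_abs_self x]
  convert! h using 1
  · ext n
    have hn : t + n - 1 - n + 1 = t := by ring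
    simp [genD_eq_multichoose, Ring.choose, hn, mul_comm]
  · rw [zero_add, Real.rpow_neg hx', one_div]

theorem min_one_mul_one_sub_le_one_sub_rpow {b u : ℝ} (hb : 0 ≤ b) (hu0 : 0 ≤ u) (hu1 : u ≤ 1) :
    min 1 b * (1 - u) ≤ 1 - u ^ b := by
  rcases le_total 1 b with h | h
  · have := Real.rpow_le_rpow_of_exponent_ge_of_imp hu0 hu1 h (by intros; linarith)
    rw [Real.rpow_one] at this
    rw [min_eq_left h]
    linarith
  · have := rpow_one_add_le_one_add_mul_self (s := u - 1) (by linarith) hb h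
    rw [add_sub_cancel] at this
    rw [min_eq_right h]
    linarith

theorem integrableOn_one_sub_rpow_neg {b t : ℝ} (hb : 0 < b) (ht0 : 0 ≤ t) (ht1 : t < 1) :
    IntegrableOn (fun u : ℝ => (1 - u ^ b) ^ (-t)) (Set.Ioo 0 1) volume := by
  have h : IntervalIntegrable (fun u : ℝ => (1 - u) ^ (-t)) volume 0 1 := by
    simpa using ((intervalIntegral.intervalIntegrable_rpow' (a := 0) (b := 1)
      (by linarith : -1 < -t)).comp_sub_left 1).symm
  rw [intervalIntegrable_iff_integrableOn_Ioo_of_le zero_le_one] at h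
  refine Integrable.mono' (h.const_mul ((min 1 b) ^ (-t)))
    (Measurable.aestronglyMeasurable (by fun_prop)) ?_
  filter_upwards [ae_restrict_mem measurableSet_Ioo] with u hu
  have hc : 0 < min 1 b := lt_min one_pos hb
  have hu1 : 0 < 1 - u := by linarith [hu.2]
  have hle := min_one_mul_one_sub_le_one_sub_rpow hb.le hu.1.le hu.2.le
  have hpos := mul_pos hc hu1
  rw [Real.norm_of_nonneg (Real.rpow_nonneg (hpos.le.trans hle) _),
    ← Real.mul_rpow hc.le hu1.le]
  exact Real.rpow_le_rpow_of_nonpos hpos hle (by linarith)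

theorem setIntegral_Ioo_rpow {r : ℝ} (hr : -1 < r) :
    ∫ u in Set.Ioo (0:ℝ) 1, u ^ r = 1 / (r + 1) := by
  rw [← integral_Ioc_eq_integral_Ioo, ← intervalIntegral.integral_of_le zero_le_one,
    integral_rpow (Or.inl hr), Real.one_rpow, Real.zero_rpow (by linarith), sub_zero]

theorem hasSum_genD_div {b t : ℝ} (hb : 0 < b) (ht0 : 0 ≤ t) (ht1 : t < 1) :
    HasSum (fun n : ℕ => genD t n / (n * b + 1))
      (∫ u in Set.Ioo (0:ℝ) 1, (1 - u ^ b) ^ (-t)) := by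
  have hlim : ∀ᵐ u ∂(volume.restrict (Set.Ioo (0:ℝ) 1)),
      HasSum (fun n : ℕ => genD t n * u ^ (n * b)) ((1 - u ^ b) ^ (-t)) := by
    filter_upwards [ae_restrict_mem measurableSet_Ioo] with u hu
    have hub : |u ^ b| < 1 := by
      rw [abs_of_nonneg (Real.rpow_nonneg hu.1.le b)]
      exact Real.rpow_lt_one hu.1.le hu.2 hb
    convert! hasSum_genD_mul_pow t hub using 3 with n
    rw [mul_comm, Real.rpow_mul_natCast hu.1.le]
  have h := hasSum_integral_of_dominated_convergence
    (fun (n : ℕ) (u : ℝ) => genD t n * u ^ (n * b))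
    (fun n => Measurable.aestronglyMeasurable (by fun_prop))
    (fun n => by
      filter_upwards [ae_restrict_mem measurableSet_Ioo] with u hu
      exact (Real.norm_of_nonneg
        (mul_nonneg (genD_nonneg ht0 n) (Real.rpow_nonneg hu.1.le _))).le)
    (hlim.mono fun u hu => hu.summable)
    ((integrableOn_one_sub_rpow_neg hb ht0 ht1).congr
      (hlim.mono fun u hu => hu.tsum_eq.symm)) hlim
  convert! h using 2 with n
  have hn : 0 ≤ n * b := by positivity
  rw [integral_const_mul, setIntegral_Ioo_rpow (by linarith), mul_one_div]

/-- For `b > 0` and `0 ≤ t < 1`, `u ↦ (1−u^b)^{−t}` is integrable on `(0,1)`,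
the series `∑ₙ D(t,n)/(nb+1)` converges, and
`∫_0^1 (1−u^b)^{−t} du = ∑_{n=0}^∞ D(t,n)/(nb+1)`. -/
theorem integral_one_sub_rpow_neg_eq_tsum (b t : ℝ) (hb : 0 < b) (ht0 : 0 ≤ t) (ht1 : t < 1) :
    IntegrableOn (fun u : ℝ => (1 - u ^ b) ^ (-t)) (Set.Ioo 0 1) volume ∧
    Summable (fun n : ℕ => genD t n / (n * b + 1)) ∧
    ∫ u in Set.Ioo (0:ℝ) 1, (1 - u ^ b) ^ (-t)
      = ∑' n : ℕ, genD t n / (n * b + 1) := by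
  have h := hasSum_genD_div hb ht0 ht1
  exact ⟨integrableOn_one_sub_rpow_neg hb ht0 ht1, h.summable, h.tsum_eq.symm⟩
end

section
/- For every real t ≥ 0, as the real parameter K tends to +∞, K·log( 1 + ∑_{n even, n≥2} C(t,n)/(n(K−1)+1) ) converges to ∑_{n even, n≥2} C(t,n)/n, where C(t,n) = (∏_{l=0}^{n−1}(t−l))/n! and both series (for each fixed K > 1, and the limiting series) converge. Equivalently, for every real ε, H1(t;ε,K) = εt − K·log(1 + ∑_{n even, n≥2} C(t,n)/(n(K−1)+1)) converges to H1(t;ε,∞) = εt − ∑_{n even, n≥2} C(t,n)/n as K → ∞. -/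
open Filter

/-- `H1(t;ε,K) = εt − K·log(1 + ∑_{n even, n≥2} C(t,n)/(n(K−1)+1))`. -/
noncomputable def H1 (t ε K : ℝ) : ℝ :=
  ε * t - K * Real.log
    (1 + ∑' m : ℕ, genC t (2 * (m + 1)) / ((2 * (m + 1) : ℕ) * (K - 1) + 1))

theorem genC_succ_mul (t : ℝ) (n : ℕ) : ((n + 1 : ℕ) : ℝ) * genC t (n + 1) = genC t n * (t - n) := by
  unfold genC
  rw [Finset.prod_range_succ, Nat.factorial_succ]
  have h : (n.factorial : ℝ) ≠ 0 := by positivity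
  have h' : ((n + 1 : ℕ) : ℝ) ≠ 0 := by positivity
  rw [Nat.cast_mul]
  field_simp

/-- For `t ≥ 0` the coefficients `C(t,n)` are `O(1/n)`. -/
theorem exists_mul_abs_genC_le (t : ℝ) (ht : 0 ≤ t) :
    ∃ M : ℝ, ∀ n : ℕ, (n : ℝ) * |genC t n| ≤ M := by
  obtain ⟨N, hN⟩ := exists_nat_ge t
  have step (n : ℕ) (hn : N ≤ n) :
      ((n + 1 : ℕ) : ℝ) * |genC t (n + 1)| ≤ n * |genC t n| := by
    have hn' : (N : ℝ) ≤ n := by exact_mod_cast hn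
    have h := congrArg abs (genC_succ_mul t n)
    rw [abs_mul, abs_mul, Nat.abs_cast] at h
    rw [h, mul_comm]
    gcongr
    rw [abs_le]
    constructor <;> linarith
  refine ⟨∑ i ∈ Finset.range (N + 1), (i : ℝ) * |genC t i|, fun n => ?_⟩
  have small (n : ℕ) (hn : n ≤ N) :
      (n : ℝ) * |genC t n| ≤ ∑ i ∈ Finset.range (N + 1), (i : ℝ) * |genC t i| :=
    Finset.single_le_sum (f := fun i : ℕ => (i : ℝ) * |genC t i|)
      (fun i _ => by positivity) (Finset.mem_range.2 (by omega))
  rcases le_total n N with hn | hn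
  · exact small n hn
  · induction n, hn using Nat.le_induction with
    | base => exact small N le_rfl
    | succ k hk ih => exact (step k hk).trans ih

theorem summable_abs_genC_div (t : ℝ) (ht : 0 ≤ t) :
    Summable (fun m : ℕ => |genC t (2 * (m + 1))| / (2 * (m + 1) : ℕ)) := by
  obtain ⟨M, hM⟩ := exists_mul_abs_genC_le t ht
  have hs : Summable (fun n : ℕ => M * (1 / (n : ℝ) ^ 2)) :=
    (Real.summable_one_div_nat_pow.2 one_lt_two).mul_left M
  have hinj : Function.Injective (fun m : ℕ => 2 * (m + 1)) := fun a b h => by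
    simp only at h
    omega
  refine Summable.of_nonneg_of_le (fun m => by positivity) (fun m => ?_)
    (hs.comp_injective hinj)
  have hpos : (0 : ℝ) < ((2 * (m + 1) : ℕ) : ℝ) := by positivity
  have h := hM (2 * (m + 1))
  simp only [Function.comp]
  rw [mul_one_div, div_le_div_iff₀ hpos (by positivity)]
  nlinarith

theorem summable_genC_div_mul_add_one (t : ℝ) (ht : 0 ≤ t) (K : ℝ) (hK : 1 < K) :
    Summable (fun m : ℕ => genC t (2 * (m + 1)) / ((2 * (m + 1) : ℕ) * (K - 1) + 1)) := by
  have hK' : 0 < K - 1 := sub_pos.2 hK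
  refine Summable.of_norm_bounded ((summable_abs_genC_div t ht).div_const (K - 1)) fun m => ?_
  have hpos : (0 : ℝ) < ((2 * (m + 1) : ℕ) : ℝ) := by positivity
  rw [Real.norm_eq_abs, abs_div, abs_of_pos (a := _ * (K - 1) + 1) (by positivity), div_div]
  gcongr
  linarith

theorem tendsto_div_mul_sub_one_add_one {c : ℝ} (hc : c ≠ 0) :
    Tendsto (fun K : ℝ => K / (c * (K - 1) + 1)) atTop (nhds (1 / c)) := by
  have h : Tendsto (fun K : ℝ => 1 / (c + (1 - c) * K⁻¹)) atTop (nhds (1 / (c + (1 - c) * 0))) :=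
    tendsto_const_nhds.div ((tendsto_inv_atTop_zero.const_mul (1 - c)).const_add c)
      (by simpa using hc)
  rw [mul_zero, add_zero] at h
  refine h.congr' ?_
  filter_upwards [eventually_gt_atTop 0] with K hK
  rw [show c * (K - 1) + 1 = K * (c + (1 - c) * K⁻¹) by field_simp; ring]
  rw [← div_div, div_self hK.ne']

theorem tendsto_mul_tsum_genC (t : ℝ) (ht : 0 ≤ t) :
    Tendsto (fun K : ℝ => K *
        ∑' m : ℕ, genC t (2 * (m + 1)) / ((2 * (m + 1) : ℕ) * (K - 1) + 1))
      atTop (nhds (∑' m : ℕ, genC t (2 * (m + 1)) / (2 * (m + 1) : ℕ))) := by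
  simp_rw [← tsum_mul_left]
  refine tendsto_tsum_of_dominated_convergence
    ((summable_abs_genC_div t ht).mul_left 2) (fun m => ?_) ?_
  · have hpos : ((2 * (m + 1) : ℕ) : ℝ) ≠ 0 := by positivity
    have h := (tendsto_div_mul_sub_one_add_one hpos).const_mul (genC t (2 * (m + 1)))
    rw [mul_one_div] at h
    refine h.congr fun K => ?_
    ring
  · filter_upwards [eventually_ge_atTop 2] with K hK m
    have hpos : (0 : ℝ) < ((2 * (m + 1) : ℕ) : ℝ) := by positivity
    generalize ((2 * (m + 1) : ℕ) : ℝ) = c at hpos ⊢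
    have hd : 0 < c * (K - 1) + 1 := by nlinarith
    rw [Real.norm_eq_abs, abs_mul, abs_div, abs_of_pos hd, abs_of_pos (by linarith : 0 < K),
      ← mul_div_assoc, ← mul_div_assoc, div_le_div_iff₀ hd hpos]
    have hKc : K * c ≤ 2 * (c * (K - 1) + 1) := by nlinarith
    nlinarith [mul_le_mul_of_nonneg_left hKc (abs_nonneg (genC t (2 * (m + 1))))]

/-- For `t ≥ 0`, as `K → +∞`,
`K·log(1 + ∑_{n even, n≥2} C(t,n)/(n(K−1)+1)) → ∑_{n even, n≥2} C(t,n)/n`; all series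
involved converge.  Equivalently, `H1(t;ε,K) → H1(t;ε,∞) = εt − ∑_{n even, n≥2} C(t,n)/n`. -/
theorem H1_tendsto_atTop (t : ℝ) (ht : 0 ≤ t) :
    (∀ K : ℝ, 1 < K →
      Summable (fun m : ℕ => genC t (2 * (m + 1)) / ((2 * (m + 1) : ℕ) * (K - 1) + 1))) ∧
    Summable (fun m : ℕ => genC t (2 * (m + 1)) / (2 * (m + 1) : ℕ)) ∧
    Tendsto (fun K : ℝ => K * Real.log
        (1 + ∑' m : ℕ, genC t (2 * (m + 1)) / ((2 * (m + 1) : ℕ) * (K - 1) + 1)))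
      atTop (nhds (∑' m : ℕ, genC t (2 * (m + 1)) / (2 * (m + 1) : ℕ))) ∧
    ∀ ε : ℝ, Tendsto (fun K : ℝ => H1 t ε K) atTop
      (nhds (ε * t - ∑' m : ℕ, genC t (2 * (m + 1)) / (2 * (m + 1) : ℕ))) := by
  have hlim := Real.tendsto_mul_log_one_add_of_tendsto (tendsto_mul_tsum_genC t ht)
  refine ⟨summable_genC_div_mul_add_one t ht, ?_, hlim, fun ε => hlim.const_sub (ε * t)⟩
  refine Summable.of_norm_bounded (summable_abs_genC_div t ht) fun m => ?_
  rw [Real.norm_eq_abs, abs_div, Nat.abs_cast]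
end

section
/- For every real K ≥ 2 there exists a real t with 0 < t < 1 such that H2(t;0,K) ≥ 1/12.3, where H2(t;0,K) = −K·log A(t,K), A(t,K) = 1 + ∑_{n even, n≥2} D(t,n)/(n(K−1)+1) − ∑_{n odd, n≥1} D(t,n)/((n+1)(K−1)+1), and D(t,n) = (∏_{l=0}^{n−1}(t+l))/n! (the series converge and A(t,K) ∈ (0,1) for such t). -/
/-- `A(t,K) = 1 + ∑_{n even, n≥2} D(t,n)/(n(K−1)+1) − ∑_{n odd, n≥1} D(t,n)/((n+1)(K−1)+1)`. -/
noncomputable def Afun (t K : ℝ) : ℝ :=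
  1 + (∑' m : ℕ, genD t (2 * (m + 1)) / ((2 * (m + 1) : ℕ) * (K - 1) + 1))
    - ∑' m : ℕ, genD t (2 * m + 1) / (((2 * m + 1 : ℕ) + 1) * (K - 1) + 1)

theorem genD_one (t : ℝ) : genD t 1 = t := by simp [genD]

theorem genD_succ (t : ℝ) (n : ℕ) : genD t (n + 1) = genD t n * (t + n) / (n + 1) := by
  have : (n.factorial : ℝ) ≠ 0 := by positivity
  simp only [genD, Finset.prod_range_succ, Nat.factorial_succ]
  push_cast
  field_simp

theorem genD_pos {t : ℝ} (ht : 0 < t) (n : ℕ) : 0 < genD t n := by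
  unfold genD
  positivity

theorem genD_sub_genD_succ (t : ℝ) (n : ℕ) :
    genD t n - genD t (n + 1) = (1 - t) * (genD t n / (n + 1)) := by
  rw [genD_succ]
  field_simp
  ring

theorem genD_succ_le {t : ℝ} (ht : 0 < t) (ht1 : t ≤ 1) (n : ℕ) :
    genD t (n + 1) ≤ genD t n := by
  have h : 0 ≤ (1 - t) * (genD t n / (n + 1)) :=
    mul_nonneg (sub_nonneg.2 ht1) (div_nonneg (genD_pos ht n).le (by positivity))
  linarith [genD_sub_genD_succ t n]

theorem sum_genD_odd_sub_even_le {t : ℝ} (ht : 0 < t) (ht1 : t ≤ 1) (N : ℕ) :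
    ∑ m ∈ Finset.range N, (genD t (2 * m + 1) - genD t (2 * m + 2)) ≤ t := by
  have h : ∑ m ∈ Finset.range N, (genD t (2 * m + 1) - genD t (2 * m + 2)) ≤
      t - genD t (2 * N + 1) := by
    induction N with
    | zero => simp [genD_one]
    | succ k ih =>
      rw [Finset.sum_range_succ]
      have := genD_succ_le ht ht1 (2 * k + 2)
      rw [show 2 * (k + 1) + 1 = 2 * k + 2 + 1 by ring]
      linarith
  linarith [genD_pos ht (2 * N + 1)]

theorem summable_genD_odd_sub_even {t : ℝ} (ht : 0 < t) (ht1 : t ≤ 1) :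
    Summable fun m : ℕ => genD t (2 * m + 1) - genD t (2 * m + 2) :=
  summable_of_sum_range_le (fun m => sub_nonneg.2 (genD_succ_le ht ht1 (2 * m + 1)))
    (sum_genD_odd_sub_even_le ht ht1)

theorem summable_genD_odd_div {t : ℝ} (ht : 0 < t) (ht1 : t < 1) :
    Summable fun m : ℕ => genD t (2 * m + 1) / (2 * m + 2) := by
  refine ((summable_genD_odd_sub_even ht ht1.le).mul_left (1 - t)⁻¹).congr fun m => ?_
  have : 1 - t ≠ 0 := by linarith
  rw [show 2 * m + 2 = 2 * m + 1 + 1 by ring, genD_sub_genD_succ]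
  push_cast
  field_simp
  ring

theorem two_mul_add_two_le_denom {K : ℝ} (hK : 2 ≤ K) (m : ℕ) :
    (2 * m + 2 : ℝ) ≤ (2 * m + 2) * (K - 1) + 1 := by
  nlinarith [mul_nonneg (by positivity : (0 : ℝ) ≤ 2 * m + 2) (sub_nonneg.2 hK)]

theorem summable_odd_terms {t K : ℝ} (ht : 0 < t) (ht1 : t < 1) (hK : 2 ≤ K) :
    Summable fun m : ℕ => genD t (2 * m + 1) / (((2 * m + 1 : ℕ) + 1) * (K - 1) + 1) := by
  have e (m : ℕ) : (((2 * m + 1 : ℕ) + 1) * (K - 1) + 1) = (2 * m + 2) * (K - 1) + 1 := by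
    push_cast; ring
  simp only [e]
  have hp (m : ℕ) : (0 : ℝ) < 2 * m + 2 := by positivity
  exact (summable_genD_odd_div ht ht1).of_nonneg_of_le
    (fun m => div_nonneg (genD_pos ht _).le ((hp m).le.trans (two_mul_add_two_le_denom hK m)))
    (fun m => div_le_div_of_nonneg_left (genD_pos ht _).le (hp m) (two_mul_add_two_le_denom hK m))

theorem summable_even_terms {t K : ℝ} (ht : 0 < t) (ht1 : t < 1) (hK : 2 ≤ K) :
    Summable fun m : ℕ => genD t (2 * (m + 1)) / ((2 * (m + 1) : ℕ) * (K - 1) + 1) := by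
  have e (m : ℕ) : ((2 * (m + 1) : ℕ) * (K - 1) + 1) = (2 * m + 2) * (K - 1) + 1 := by
    push_cast; ring
  simp only [e]
  have hp (m : ℕ) : (0 : ℝ) < 2 * m + 2 := by positivity
  exact (summable_genD_odd_div ht ht1).of_nonneg_of_le
    (fun m => div_nonneg (genD_pos ht _).le ((hp m).le.trans (two_mul_add_two_le_denom hK m)))
    (fun m => div_le_div₀ (genD_pos ht _).le (genD_succ_le ht ht1.le (2 * m + 1)) (hp m)
      (two_mul_add_two_le_denom hK m))

theorem hasSum_one_sub_Afun {t K : ℝ} (ht : 0 < t) (ht1 : t < 1) (hK : 2 ≤ K) :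
    HasSum (fun m : ℕ => (genD t (2 * m + 1) - genD t (2 * m + 2)) / ((2 * m + 2) * (K - 1) + 1))
      (1 - Afun t K) := by
  have h := (summable_odd_terms ht ht1 hK).hasSum.sub (summable_even_terms ht ht1 hK).hasSum
  convert h using 1
  · rfl
  · funext m
    rw [sub_div]
    push_cast
    ring_nf
  · unfold Afun
    ring

theorem one_sub_Afun_le {t K : ℝ} (ht : 0 < t) (ht1 : t < 1) (hK : 2 ≤ K) :
    1 - Afun t K ≤ t := by
  have h := hasSum_one_sub_Afun ht ht1 hK
  refine (hasSum_le (fun m => ?_) h (summable_genD_odd_sub_even ht ht1.le).hasSum).trans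
    (Real.tsum_le_of_sum_range_le (fun m => sub_nonneg.2 (genD_succ_le ht ht1.le (2 * m + 1)))
      (sum_genD_odd_sub_even_le ht ht1.le))
  refine div_le_self (sub_nonneg.2 (genD_succ_le ht ht1.le (2 * m + 1))) ?_
  have := two_mul_add_two_le_denom hK m
  have : (0 : ℝ) ≤ m := m.cast_nonneg
  linarith

theorem sum_le_mul_one_sub_Afun {t K : ℝ} (ht : 0 < t) (ht1 : t < 1) (hK : 2 ≤ K) (N : ℕ) :
    ∑ m ∈ Finset.range N, (1 - t) * genD t (2 * m + 1) / (2 * m + 2) ^ 2 ≤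
      K * (1 - Afun t K) := by
  have h := (hasSum_one_sub_Afun ht ht1 hK).mul_left K
  have hd (m : ℕ) : (0 : ℝ) < (2 * m + 2) * (K - 1) + 1 :=
    (by positivity : (0 : ℝ) < 2 * m + 2).trans_le (two_mul_add_two_le_denom hK m)
  have hD (m : ℕ) : 0 ≤ genD t (2 * m + 1) - genD t (2 * m + 2) :=
    sub_nonneg.2 (genD_succ_le ht ht1.le (2 * m + 1))
  refine (Finset.sum_le_sum fun m _ => ?_).trans
    (sum_le_hasSum (Finset.range N)
      (fun m _ => mul_nonneg (by linarith) (div_nonneg (hD m) (hd m).le)) h)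
  have e : (1 - t) * genD t (2 * m + 1) / (2 * m + 2) ^ 2 =
      (genD t (2 * m + 1) - genD t (2 * m + 2)) * (1 / (2 * m + 2)) := by
    rw [show 2 * m + 2 = 2 * m + 1 + 1 by ring, genD_sub_genD_succ]
    push_cast
    field_simp
    ring
  have hfrac : (1 : ℝ) / (2 * m + 2) ≤ K / ((2 * m + 2) * (K - 1) + 1) := by
    rw [div_le_div_iff₀ (by positivity) (hd m)]
    have : (0 : ℝ) ≤ m := m.cast_nonneg
    linarith
  calc _ = _ := e
    _ ≤ _ := mul_le_mul_of_nonneg_left hfrac (hD m)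
    _ = _ := by ring

theorem le_sum_genD :
    (1 / 12.3 : ℝ) ≤ ∑ m ∈ Finset.range 36,
      (1 - 11 / 20) * genD (11 / 20) (2 * m + 1) / (2 * m + 2) ^ 2 := by
  norm_num [genD, Finset.sum_range_succ, Finset.prod_range_succ, Nat.factorial]

/-- For every real `K ≥ 2` there is `t ∈ (0,1)` with `H2(t;0,K) = −K·log A(t,K) ≥ 1/12.3`;
moreover the series defining `A(t,K)` converge and `A(t,K) ∈ (0,1)`. -/
theorem exists_t_H2_ge (K : ℝ) (hK : 2 ≤ K) :
    ∃ t : ℝ, 0 < t ∧ t < 1 ∧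
      Summable (fun m : ℕ => genD t (2 * (m + 1)) / ((2 * (m + 1) : ℕ) * (K - 1) + 1)) ∧
      Summable (fun m : ℕ => genD t (2 * m + 1) / (((2 * m + 1 : ℕ) + 1) * (K - 1) + 1)) ∧
      (0 < Afun t K) ∧ (Afun t K < 1) ∧
      (1 / 12.3 : ℝ) ≤ -K * Real.log (Afun t K) := by
  have ht : (0 : ℝ) < 11 / 20 := by norm_num
  have ht1 : (11 / 20 : ℝ) < 1 := by norm_num
  have hle := le_sum_genD.trans (sum_le_mul_one_sub_Afun ht ht1 hK 36)
  have hpos : 0 < Afun (11 / 20) K := by linarith [one_sub_Afun_le ht ht1 hK]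
  have hlt : 0 < 1 - Afun (11 / 20) K :=
    pos_of_mul_pos_right (lt_of_lt_of_le (by norm_num) hle) (by linarith)
  refine ⟨_, ht, ht1, summable_even_terms ht ht1 hK, summable_odd_terms ht ht1 hK, hpos,
    by linarith, hle.trans ?_⟩
  have hlog := mul_le_mul_of_nonneg_left (Real.log_le_sub_one_of_pos hpos) (by linarith : 0 ≤ K)
  linarith
end
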